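/- Let 0 < L < 1/2 and 0 < l ≤ 1, and let Ω̄ = [-1/2, 1/2] × [0, 1]. Suppose f : ℝ² → ℝ is C² on Ω̄ and satisfies: (i) ∂_x f(x, y) = 0 for all (x, y) ∈ Ω̄; (ii) ∂_y ∂_y f(x, y) = 0 for all (x, y) ∈ Ω̄; (iii) ∂_y f(x, 1) = 0 for all x ∈ [-1/2, 1/2]; and (iv) f(L, y) = 0 for all y ∈ [0, l]. Then f = 0 on Ω̄. In particular, for such smooth functions the quantity ⟨f, f⟩_V = ∫_Ω (∂_x f)² + ∫_Ω (∂_y² f)² + 2 ∫_0^l f(L, y)² dy vanishes only when f vanishes identically. -/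

import Mathlib

open Set MeasureTheory

/-- A function continuous on `[a, b]` whose derivative exists and vanishes on `(a, b)` is constant
on `[a, b]`. -/
theorem eq_of_deriv_eq_zero_on_Ioo {g : ℝ → ℝ} {a b : ℝ} (hc : ContinuousOn g (Icc a b))
    (hd : DifferentiableOn ℝ g (Ioo a b)) (h0 : ∀ x ∈ Ioo a b, deriv g x = 0)
    {x y : ℝ} (hx : x ∈ Icc a b) (hy : y ∈ Icc a b) : g x = g y := by
  rw [← interior_Icc] at hd h0
  have hmono : MonotoneOn g (Icc a b) :=
    monotoneOn_of_deriv_nonneg (convex_Icc a b) hc hd fun z hz => (h0 z hz).ge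
  have hanti : AntitoneOn g (Icc a b) :=
    antitoneOn_of_deriv_nonpos (convex_Icc a b) hc hd fun z hz => (h0 z hz).le
  rcases le_total x y with h | h
  · exact le_antisymm (hmono hx hy h) (hanti hx hy h)
  · exact le_antisymm (hanti hy hx h) (hmono hy hx h)

/-- A `C²` function on `[a, b]` with vanishing second derivative on `(a, b)` that is zero on a
nontrivial initial segment `[a, c]` is zero on `[a, b]`. -/
theorem eq_zero_of_deriv_deriv_eq_zero {g : ℝ → ℝ} {a b c : ℝ} (hac : a < c) (hcb : c ≤ b)
    (hg : ContDiffOn ℝ 2 g (Icc a b)) (h2 : ∀ y ∈ Ioo a b, deriv (deriv g) y = 0)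
    (h0 : ∀ y ∈ Icc a c, g y = 0) {y : ℝ} (hy : y ∈ Icc a b) : g y = 0 := by
  have hgo : ContDiffOn ℝ 2 g (Ioo a b) := hg.mono Ioo_subset_Icc_self
  have hd : DifferentiableOn ℝ (deriv g) (Ioo a b) :=
    (hgo.deriv_of_isOpen (m := 1) isOpen_Ioo (by norm_num)).differentiableOn (by norm_num)
  obtain ⟨m, ham, hmc⟩ := exists_between hac
  have hm : deriv g m = 0 := by
    have hev : g =ᶠ[nhds m] fun _ => 0 := by
      filter_upwards [Icc_mem_nhds ham hmc] with z hz using h0 z hz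
    rw [hev.deriv_eq, deriv_const]
  have h1 : ∀ z ∈ Ioo a b, deriv g z = 0 := fun z hz =>
    (isOpen_Ioo.is_const_of_deriv_eq_zero isPreconnected_Ioo hd h2 hz
      ⟨ham, hmc.trans_le hcb⟩).trans hm
  have ha : a ∈ Icc a b := ⟨le_rfl, hac.le.trans hcb⟩
  rw [eq_of_deriv_eq_zero_on_Ioo hg.continuousOn (hgo.differentiableOn (by norm_num)) h1 hy ha]
  exact h0 a ⟨le_rfl, hac.le⟩

/-- Positive definiteness of the scalar product of the space `V` on
`Ω̄ = [-1/2, 1/2] × [0, 1]`: if `f` is `C²` on `Ω̄` with `∂ₓ f = 0` on `Ω̄`,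
`∂_y² f = 0` on `Ω̄`, the Neumann condition `∂_y f(·, 1) = 0`, and `f(L, ·) = 0`
on `[0, l]`, then `f = 0` on `Ω̄`; in particular
`⟨f, f⟩_V = ∫_Ω (∂ₓ f)² + ∫_Ω (∂_y² f)² + 2 ∫₀^l f(L, y)² dy` vanishes only when
`f` vanishes identically. -/
theorem V_inner_positive_definite
    (L l : ℝ) (hL0 : 0 < L) (hL : L < 1/2) (hl0 : 0 < l) (hl : l ≤ 1)
    (f : ℝ → ℝ → ℝ)
    (hf : ContDiffOn ℝ 2 (fun p : ℝ × ℝ => f p.1 p.2)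
      (Icc (-(1:ℝ)/2) (1/2) ×ˢ Icc (0:ℝ) 1))
    (hx : ∀ x ∈ Icc (-(1:ℝ)/2) (1/2), ∀ y ∈ Icc (0:ℝ) 1,
      deriv (fun s => f s y) x = 0)
    (hyy : ∀ x ∈ Icc (-(1:ℝ)/2) (1/2), ∀ y ∈ Icc (0:ℝ) 1,
      deriv (deriv (f x)) y = 0)
    (hneumann : ∀ x ∈ Icc (-(1:ℝ)/2) (1/2), deriv (f x) 1 = 0)
    (hbc : ∀ y ∈ Icc (0:ℝ) l, f L y = 0) :
    (∀ x ∈ Icc (-(1:ℝ)/2) (1/2), ∀ y ∈ Icc (0:ℝ) 1, f x y = 0) ∧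
    (((∫ p in Icc (-(1:ℝ)/2) (1/2) ×ˢ Icc (0:ℝ) 1,
          (deriv (fun s => f s p.2) p.1) ^ 2) +
        (∫ p in Icc (-(1:ℝ)/2) (1/2) ×ˢ Icc (0:ℝ) 1,
          (deriv (deriv (f p.1)) p.2) ^ 2) +
        2 * ∫ y in (0:ℝ)..l, (f L y) ^ 2) = 0 →
      ∀ x ∈ Icc (-(1:ℝ)/2) (1/2), ∀ y ∈ Icc (0:ℝ) 1, f x y = 0) := by
  have hLmem : L ∈ Icc (-(1:ℝ)/2) (1/2) := ⟨by linarith, hL.le⟩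
  have key : ∀ x ∈ Icc (-(1:ℝ)/2) (1/2), ∀ y ∈ Icc (0:ℝ) 1, f x y = 0 := by
    intro x hxm y hym
    have hrow : ContDiffOn ℝ 2 (fun s => f s y) (Icc (-(1:ℝ)/2) (1/2)) :=
      hf.comp (f := fun s : ℝ => (s, y)) (by fun_prop) fun s hs => ⟨hs, hym⟩
    have hcol : ContDiffOn ℝ 2 (f L) (Icc (0:ℝ) 1) :=
      hf.comp (f := fun t : ℝ => (L, t)) (by fun_prop) fun t ht => ⟨hLmem, ht⟩
    have hconst : f x y = f L y :=
      eq_of_deriv_eq_zero_on_Ioo (g := fun s => f s y) hrow.continuousOn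
        ((hrow.differentiableOn (by norm_num)).mono Ioo_subset_Icc_self)
        (fun s hs => hx s (Ioo_subset_Icc_self hs) y hym) hxm hLmem
    rw [hconst]
    exact eq_zero_of_deriv_deriv_eq_zero hl0 hl hcol
      (fun t ht => hyy L hLmem t (Ioo_subset_Icc_self ht)) hbc hym
  exact ⟨key, fun _ => key⟩
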